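/- 𝒟_2, the set of curves of 𝒞^2 having 0 as an endpoint, covers the cube P_{0,1}: every segment containing a point of P_{0,1} belongs to exactly one curve of 𝒟_2. -/

import Mathlib

namespace Folding

noncomputable section

open Set

/-- Points of `ℝ^n` with the euclidean distance. -/
abbrev Pt (n : ℕ) := EuclideanSpace ℝ (Fin n)

/-- `p` is a point of the lattice `ℤ^n`. -/
def latt {n : ℕ} (p : Pt n) : Prop := ∀ i, ∃ m : ℤ, p i = (m : ℝ)

/-- `p` belongs to `m·ℤ^n`. -/
def inLat {n : ℕ} (m : ℕ) (p : Pt n) : Prop := ∀ i, ∃ c : ℤ, p i = (m : ℝ) * (c : ℝ)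

/-- The canonical basis vector `e_i`. -/
def uvec (n : ℕ) (i : Fin n) : Pt n := EuclideanSpace.single i (1 : ℝ)

/-- `u` belongs to `E = {e_1, -e_1, …, e_n, -e_n}`. -/
def IsDir {n : ℕ} (u : Pt n) : Prop := ∃ i, u = uvec n i ∨ u = -uvec n i

/-- A (nonoriented) lattice segment `[x, x + e_i]`, as an unordered pair of endpoints. -/
def IsSeg {n : ℕ} (S : Sym2 (Pt n)) : Prop := ∃ x i, latt x ∧ S = s(x, x + uvec n i)

/-- A curve: a sequence of segments, indexed by an interval of `ℤ` (finite, ℕ-like or ℤ-like),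
recorded through its sequence of vertices; two consecutive segments have exactly one common
endpoint, and the common endpoints with the preceding and the following segments differ
(`noback`). -/
structure Curve (n : ℕ) where
  dom : Set ℤ
  ordConn : dom.OrdConnected
  nontriv : ∃ i, i ∈ dom ∧ i + 1 ∈ dom
  v : ℤ → Pt n
  lattice : ∀ i ∈ dom, latt (v i)
  step : ∀ i : ℤ, i ∈ dom → i + 1 ∈ dom →
    ∃ j, v (i + 1) = v i + uvec n j ∨ v (i + 1) = v i - uvec n j
  noback : ∀ i : ℤ, i - 1 ∈ dom → i + 1 ∈ dom → v (i + 1) ≠ v (i - 1)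

namespace Curve

variable {n : ℕ} (c : Curve n)

/-- The segments of a curve. -/
def segs : Set (Sym2 (Pt n)) :=
  {S | ∃ i : ℤ, i ∈ c.dom ∧ i + 1 ∈ c.dom ∧ S = s(c.v i, c.v (i + 1))}

/-- The connexions between segments of a curve: pairs of consecutive segments. -/
def conn (S T : Sym2 (Pt n)) : Prop :=
  ∃ i : ℤ, i - 1 ∈ c.dom ∧ i + 1 ∈ c.dom ∧
    ((S = s(c.v (i - 1), c.v i) ∧ T = s(c.v i, c.v (i + 1))) ∨
     (T = s(c.v (i - 1), c.v i) ∧ S = s(c.v i, c.v (i + 1))))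

/-- A curve is self-avoiding if each of its segments appears only once. -/
def SelfAvoiding : Prop :=
  ∀ i j : ℤ, i ∈ c.dom → i + 1 ∈ c.dom → j ∈ c.dom → j + 1 ∈ c.dom →
    s(c.v i, c.v (i + 1)) = s(c.v j, c.v (j + 1)) → i = j

/-- A curve without endpoints (indexed by `ℤ`). -/
def NoEndpts : Prop := c.dom = Set.univ

/-- `p` is an endpoint of the curve `c`. -/
def IsEndpt (p : Pt n) : Prop :=
  ∃ i ∈ c.dom, p = c.v i ∧ (i - 1 ∉ c.dom ∨ i + 1 ∉ c.dom)

/-- `S` is the end segment of `c` at its endpoint `p`. -/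
def endSegAt (p : Pt n) (S : Sym2 (Pt n)) : Prop :=
  ∃ i : ℤ, i ∈ c.dom ∧ p = c.v i ∧
    ((i - 1 ∉ c.dom ∧ i + 1 ∈ c.dom ∧ S = s(c.v i, c.v (i + 1))) ∨
     (i + 1 ∉ c.dom ∧ i - 1 ∈ c.dom ∧ S = s(c.v (i - 1), c.v i)))

/-- The number of segments (length) of a curve. -/
def nsegs : ℕ := {i : ℤ | i ∈ c.dom ∧ i + 1 ∈ c.dom}.ncard

end Curve

/-- The trace of a set of curves: its set of segments together with the connexion
relation between segments.  Two sets of curves are geometrically the same set of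
(nonoriented) curves iff they have the same trace. -/
structure Trace (n : ℕ) where
  segs : Set (Sym2 (Pt n))
  conn : Sym2 (Pt n) → Sym2 (Pt n) → Prop

def curveTrace {n : ℕ} (c : Curve n) : Trace n := ⟨c.segs, c.conn⟩

def traceOf {n : ℕ} (E : Set (Curve n)) : Trace n :=
  ⟨{S | ∃ c ∈ E, S ∈ c.segs}, fun S T => ∃ c ∈ E, c.conn S T⟩

/-- Two curves are the same nonoriented curve. -/
def SameCurve {n : ℕ} (c d : Curve n) : Prop := c.segs = d.segs ∧ c.conn = d.conn

/-- A set of pairwise disjoint self-avoiding curves. -/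
def DisjSA {n : ℕ} (E : Set (Curve n)) : Prop :=
  (∀ c ∈ E, c.SelfAvoiding) ∧
  ∀ c ∈ E, ∀ d ∈ E, ¬ SameCurve c d → ∀ S, S ∈ c.segs → S ∉ d.segs

/-- The set of points of `ℝ^n` lying on the segment `S`. -/
def segPts {n : ℕ} (S : Sym2 (Pt n)) : Set (Pt n) :=
  {p | ∃ a b, S = s(a, b) ∧ ∃ t : ℝ, 0 ≤ t ∧ t ≤ 1 ∧ p = a + t • (b - a)}

def Trace.pts {n : ℕ} (T : Trace n) : Set (Pt n) := ⋃ S ∈ T.segs, segPts S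

/-- A set of curves covers `X ⊆ ℝ^n`: each lattice segment containing a point of `X`
appears in one and only one of the curves. -/
def Covers {n : ℕ} (E : Set (Curve n)) (X : Set (Pt n)) : Prop :=
  ∀ S, IsSeg S → (segPts S ∩ X).Nonempty →
    (∃ c ∈ E, S ∈ c.segs) ∧ ∀ c ∈ E, ∀ d ∈ E, S ∈ c.segs → S ∈ d.segs → SameCurve c d

/-- A covering of `ℝ^n` by disjoint self-avoiding curves. -/
def IsCovering {n : ℕ} (E : Set (Curve n)) : Prop := DisjSA E ∧ Covers E Set.univ

/-- A single curve covers `X`. -/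
def CurveCovers {n : ℕ} (c : Curve n) (X : Set (Pt n)) : Prop :=
  ∀ S, IsSeg S → (segPts S ∩ X).Nonempty → S ∈ c.segs

/-- `b` is a curve contained in the curve `a`. -/
def SubCurve {n : ℕ} (b a : Curve n) : Prop :=
  b.segs ⊆ a.segs ∧ ∀ S T, b.conn S T → a.conn S T

/-- The relation `≺` at the level of traces. -/
def TPrec {n : ℕ} (T T' : Trace n) : Prop :=
  T.segs ⊆ T'.segs ∧ ∀ S S', T.conn S S' → T'.conn S S'

/-- `E ≺ F` : each segment of a curve of `E` is a segment of a curve of `F` and each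
connexion between two segments of a curve of `E` also exists in `F`. -/
def Prec {n : ℕ} (E F : Set (Curve n)) : Prop := TPrec (traceOf E) (traceOf F)

/-- Image of a trace under a map of `ℝ^n`. -/
def Trace.map {n : ℕ} (f : Pt n → Pt n) (T : Trace n) : Trace n :=
  ⟨Sym2.map f '' T.segs,
   fun S S' => ∃ A B, T.conn A B ∧ S = Sym2.map f A ∧ S' = Sym2.map f B⟩

/-- Translation of a trace by the vector `t`. -/
def Trace.transl {n : ℕ} (t : Pt n) (T : Trace n) : Trace n := T.map (fun p => p + t)

/-- Property (H) for the pair `(k, l)`. -/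
def SatH {n : ℕ} (A : Set (Curve n)) (k l : ℕ) : Prop :=
  0 < k ∧ 0 < l ∧ k ∣ l ∧ IsCovering A ∧
  (∀ c ∈ A, c.dom.Finite ∧ ∃ x i, latt x ∧ inLat k x ∧ c.IsEndpt x ∧
      c.IsEndpt (x + (k : ℝ) • uvec n i) ∧
      ∀ p, c.IsEndpt p → p = x ∨ p = x + (k : ℝ) • uvec n i) ∧
  (∀ (x : Pt n) (i : Fin n), latt x → inLat k x →
      (∃ c ∈ A, c.IsEndpt x ∧ c.IsEndpt (x + (k : ℝ) • uvec n i)) ∧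
      ∀ c ∈ A, ∀ d ∈ A, c.IsEndpt x → c.IsEndpt (x + (k : ℝ) • uvec n i) →
        d.IsEndpt x → d.IsEndpt (x + (k : ℝ) • uvec n i) → SameCurve c d) ∧
  (∀ t : Pt n, inLat l t → Trace.transl t (traceOf A) = traceOf A)

/-- The trace of the convolution product `A ∗ B`, where `A` satisfies (H) for `(k, l)`:
apply to `B` the homothety of center `0` and ratio `k`, then replace each resulting
segment by the curve of `A` having the same endpoints (connexions come from the curves
of `A`, together with the junctions of the end segments of consecutive `A`-curves). -/
def ConvTrace {n : ℕ} (k : ℕ) (A B : Set (Curve n)) : Trace n where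
  segs := {S | ∃ a b : Pt n, s(a, b) ∈ (traceOf B).segs ∧
    ∃ c ∈ A, c.IsEndpt ((k : ℝ) • a) ∧ c.IsEndpt ((k : ℝ) • b) ∧ S ∈ c.segs}
  conn := fun S S' =>
    (∃ a b : Pt n, s(a, b) ∈ (traceOf B).segs ∧
      ∃ c ∈ A, c.IsEndpt ((k : ℝ) • a) ∧ c.IsEndpt ((k : ℝ) • b) ∧ c.conn S S') ∨
    (∃ a b d : Pt n, (traceOf B).conn s(a, b) s(b, d) ∧
      ∃ c ∈ A, ∃ c' ∈ A, c.IsEndpt ((k : ℝ) • a) ∧ c.IsEndpt ((k : ℝ) • b) ∧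
        c'.IsEndpt ((k : ℝ) • b) ∧ c'.IsEndpt ((k : ℝ) • d) ∧
        ((c.endSegAt ((k : ℝ) • b) S ∧ c'.endSegAt ((k : ℝ) • b) S') ∨
         (c.endSegAt ((k : ℝ) • b) S' ∧ c'.endSegAt ((k : ℝ) • b) S)))

/-- The two-sided identity of the convolution product: the covering consisting of all
curves with one segment. -/
def unitTrace (n : ℕ) : Trace n := ⟨{S | IsSeg S}, fun _ _ => False⟩

/-- `P s` realizes the power `A^s` for the convolution product. -/
def PowersOf {n : ℕ} (A : Set (Curve n)) (k : ℕ) (P : ℕ → Set (Curve n)) : Prop :=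
  (∀ s, DisjSA (P s)) ∧ traceOf (P 0) = unitTrace n ∧
  ∀ s, traceOf (P (s + 1)) = ConvTrace k A (P s)

/-- The trace of `Â`, the inductive limit of the `A^s` for `≺`. -/
def hatTrace {n : ℕ} (P : ℕ → Set (Curve n)) : Trace n :=
  ⟨{S | ∃ s, S ∈ (traceOf (P s)).segs}, fun S T => ∃ s, (traceOf (P s)).conn S T⟩

/-- A pairing relation on `E = {e_1, -e_1, …, e_n, -e_n}`. -/
def IsPairing {n : ℕ} (R : Pt n → Pt n → Prop) : Prop :=
  (∀ u v, R u v → R v u) ∧ (∀ u v, R u v → IsDir u ∧ IsDir v) ∧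
  (∀ u, ¬ R u u) ∧ ∀ u, IsDir u → ∃! v, R u v

/-- The trace of `Â_R` : `Â` with the segments with endpoint `0` connected according
to `R`. -/
def hatRTrace {n : ℕ} (P : ℕ → Set (Curve n)) (R : Pt n → Pt n → Prop) : Trace n :=
  ⟨(hatTrace P).segs,
   fun S T => (hatTrace P).conn S T ∨
     ∃ u v, R u v ∧ S = s((0 : Pt n), u) ∧ T = s((0 : Pt n), v)⟩

/-- The cube `P_{x,h}`. -/
def cube {n : ℕ} (x : Pt n) (h : ℕ) : Set (Pt n) :=
  {p | ∀ i, x i - h ≤ p i ∧ p i ≤ x i + h}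

/-- Restriction of a trace to a region `X` of `ℝ^n`. -/
def Trace.restr {n : ℕ} (T : Trace n) (X : Set (Pt n)) : Trace n :=
  ⟨{S | S ∈ T.segs ∧ segPts S ⊆ X},
   fun S S' => T.conn S S' ∧ segPts S ⊆ X ∧ segPts S' ⊆ X⟩

/-- Condition (C). -/
def CondC {n : ℕ} (T : Trace n) : Prop :=
  ∀ (x : Pt n) (h : ℕ), latt x → 1 ≤ h →
    ∃ y : Pt n, latt y ∧ y ∉ cube x h ∧
      Trace.transl (y - x) (T.restr (cube x h)) = T.restr (cube y h)

/-- `(B(x,r) ∩ T, x) ≅ (B(y,r) ∩ T', y)` : the translation sending `x` to `y` maps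
the part of `T` in the closed ball `B(x,r)` onto the part of `T'` in `B(y,r)`,
preserving the connexions between segments. -/
def BallIso {n : ℕ} (T : Trace n) (x : Pt n) (T' : Trace n) (y : Pt n) (r : ℝ) : Prop :=
  (fun p => p + (y - x)) '' (T.pts ∩ Metric.closedBall x r) =
      T'.pts ∩ Metric.closedBall y r ∧
  (∀ S S', T.conn S S' → segPts S ⊆ Metric.closedBall x r →
      segPts S' ⊆ Metric.closedBall x r →
      T'.conn (Sym2.map (fun p => p + (y - x)) S) (Sym2.map (fun p => p + (y - x)) S')) ∧
  (∀ S S', T'.conn S S' → segPts S ⊆ Metric.closedBall y r →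
      segPts S' ⊆ Metric.closedBall y r →
      T.conn (Sym2.map (fun p => p + (x - y)) S) (Sym2.map (fun p => p + (x - y)) S'))

/-- The local isomorphism property. -/
def LocIsoProp {n : ℕ} (T : Trace n) : Prop :=
  ∀ (x : Pt n) (r : ℝ), 0 ≤ r →
    ∃ t : ℝ, 0 ≤ t ∧ ∀ y : Pt n, ∃ z ∈ Metric.closedBall y t, BallIso T x T z r

/-- Two traces are locally isomorphic. -/
def LocallyIso {n : ℕ} (T T' : Trace n) : Prop :=
  (∀ (x : Pt n) (r : ℝ), 0 ≤ r → ∃ y, BallIso T x T' y r) ∧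
  (∀ (y : Pt n) (r : ℝ), 0 ≤ r → ∃ x, BallIso T' y T x r)

/-- `Ω_{s,x}` : suppress the connexions between segments whose common endpoint lies in
`x + k^s ℤ^n`. -/
def OmegaTrace {n : ℕ} (k s : ℕ) (x : Pt n) (T : Trace n) : Trace n :=
  ⟨T.segs, fun S S' => T.conn S S' ∧ ¬ ∃ p, p ∈ S ∧ p ∈ S' ∧ inLat (k ^ s) (p - x)⟩

/-- `Σ_{s,x}(E)` : for each curve `D` of `E` passing through `x`, the curve(s) with
endpoint `x` contained in `D` having maximal length, this length being limited to
`8^s`. -/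
def SigmaSet {n : ℕ} (s : ℕ) (x : Pt n) (E : Set (Curve n)) : Set (Curve n) :=
  {b | ∃ D ∈ E, SubCurve b D ∧ b.IsEndpt x ∧ b.nsegs ≤ 8 ^ s ∧
    ∀ b' : Curve n, SubCurve b' D → b'.IsEndpt x → b'.nsegs ≤ 8 ^ s →
      SubCurve b b' → SameCurve b b'}

/-- A positive (orientation preserving) isometry of `ℝ^n`. -/
def PosIsom {n : ℕ} (f : Pt n → Pt n) : Prop :=
  ∃ (g : Pt n ≃ₗᵢ[ℝ] Pt n) (t : Pt n), (∀ x, f x = g x + t) ∧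
    0 < LinearMap.det (g.toLinearEquiv.toLinearMap)

/-- `E` consists of exactly `m` curves. -/
def HasExactly {n : ℕ} (E : Set (Curve n)) (m : ℕ) : Prop :=
  ∃ L : List (Curve n), L.length = m ∧ (∀ c ∈ L, c ∈ E) ∧
    L.Pairwise (fun c d => ¬ SameCurve c d) ∧ ∀ c ∈ E, ∃ d ∈ L, SameCurve c d

/-- `E` consists of at most `m` curves. -/
def AtMost {n : ℕ} (E : Set (Curve n)) (m : ℕ) : Prop :=
  ∃ L : List (Curve n), L.length ≤ m ∧ ∀ c ∈ E, ∃ d ∈ L, SameCurve c d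

/-- The set of points of a curve. -/
def curvePts {n : ℕ} (c : Curve n) : Set (Pt n) := ⋃ S ∈ c.segs, segPts S

-- ℝ³-specific part
def toPt3 (f : Fin 3 → ℝ) : Pt 3 := (WithLp.equiv 2 (Fin 3 → ℝ)).symm f

def p3 (a b c : ℤ) : Pt 3 := toPt3 ![(a : ℝ), (b : ℝ), (c : ℝ)]

/-- The vertices of the curve `C`. -/
def CList : List (Pt 3) :=
  [p3 0 0 0, p3 0 (-1) 0, p3 0 (-1) (-1), p3 0 0 (-1), p3 1 0 (-1),
   p3 1 (-1) (-1), p3 1 (-1) 0, p3 1 0 0, p3 2 0 0]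

/-- The block `ℬ₀` : six curves given by their lists of successive vertices. -/
def B0 : List (List (Pt 3)) :=
  [ CList,
    [p3 0 0 0, p3 0 0 1, p3 0 1 1, p3 0 1 0, p3 (-1) 1 0, p3 (-1) 1 1,
     p3 (-1) 0 1, p3 (-1) 0 0, p3 (-2) 0 0],
    [p3 0 0 0, p3 0 0 (-1), p3 (-1) 0 (-1), p3 (-1) 0 0, p3 (-1) 1 0,
     p3 (-1) 1 (-1), p3 0 1 (-1), p3 0 1 0, p3 0 2 0],
    [p3 0 0 0, p3 1 0 0, p3 1 0 1, p3 0 0 1, p3 0 (-1) 1, p3 1 (-1) 1,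
     p3 1 (-1) 0, p3 0 (-1) 0, p3 0 (-2) 0],
    [p3 0 0 0, p3 (-1) 0 0, p3 (-1) (-1) 0, p3 0 (-1) 0, p3 0 (-1) 1,
     p3 (-1) (-1) 1, p3 (-1) 0 1, p3 0 0 1, p3 0 0 2],
    [p3 0 0 0, p3 0 1 0, p3 1 1 0, p3 1 0 0, p3 1 0 (-1), p3 1 1 (-1),
     p3 0 1 (-1), p3 0 0 (-1), p3 0 0 (-2)] ]

def sigma3 : Pt 3 → Pt 3 := fun x => toPt3 ![x 0, -(x 1), -(x 2)]
def tau3 : Pt 3 → Pt 3 := fun x => toPt3 ![x 0, x 2, -(x 1)]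
def ups3 : Pt 3 → Pt 3 := fun x => toPt3 ![x 0, -(x 2), x 1]

/-- The four blocks `ℬ₀, ℬ₁, ℬ₂, ℬ₃`. -/
def blockLists : Fin 4 → List (List (Pt 3)) :=
  ![B0,
    B0.map (List.map fun p => p3 2 2 0 + sigma3 p),
    B0.map (List.map fun p => p3 2 0 2 + tau3 p),
    B0.map (List.map fun p => p3 0 2 2 + ups3 p)]

def listSegs (L : List (Pt 3)) : Set (Sym2 (Pt 3)) :=
  {S | ∃ j : ℕ, j + 1 < L.length ∧ S = s(L.getD j 0, L.getD (j + 1) 0)}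

def listConn (L : List (Pt 3)) (S T : Sym2 (Pt 3)) : Prop :=
  ∃ j : ℕ, j + 2 < L.length ∧
    ((S = s(L.getD j 0, L.getD (j + 1) 0) ∧ T = s(L.getD (j + 1) 0, L.getD (j + 2) 0)) ∨
     (T = s(L.getD j 0, L.getD (j + 1) 0) ∧ S = s(L.getD (j + 1) 0, L.getD (j + 2) 0)))

/-- The trace of the curve given by a list of successive vertices. -/
def listTrace (L : List (Pt 3)) : Trace 3 := ⟨listSegs L, listConn L⟩

/-- The trace of the covering `𝒞 = ⋃_{u ∈ ℤ³, 0 ≤ i ≤ 3} (4u + ℬ_i)`. -/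
def CTrace : Trace 3 where
  segs := {S | ∃ u : Pt 3, latt u ∧ ∃ (i : Fin 4), ∃ M ∈ blockLists i,
    S ∈ (Trace.transl ((4 : ℝ) • u) (listTrace M)).segs}
  conn := fun S T => ∃ u : Pt 3, latt u ∧ ∃ (i : Fin 4), ∃ M ∈ blockLists i,
    (Trace.transl ((4 : ℝ) • u) (listTrace M)).conn S T

open Classical in
/-- The permutation `θ` of `E` with `θ(e₁) = -e₂`, `θ(e₂) = -e₃`, `θ(e₃) = -e₁`
and `θ² = Id`. -/
def theta3 : Pt 3 → Pt 3 := fun u =>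
  if u = uvec 3 0 then -uvec 3 1
  else if u = -uvec 3 1 then uvec 3 0
  else if u = uvec 3 1 then -uvec 3 2
  else if u = -uvec 3 2 then uvec 3 1
  else if u = uvec 3 2 then -uvec 3 0
  else if u = -uvec 3 0 then uvec 3 2
  else u

/-- `R^θ`. -/
def Rtheta (R : Pt 3 → Pt 3 → Prop) : Pt 3 → Pt 3 → Prop :=
  fun u v => R (theta3 u) (theta3 v)

def Rx (P : ℕ → Set (Curve 3)) (x : Pt 3) : Pt 3 → Pt 3 → Prop :=
  fun u v => (hatTrace P).conn s(x, x + u) s(x, x + v)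

/-- Condition (P). -/
def SatP (P : ℕ → Set (Curve 3)) (R : Pt 3 → Pt 3 → Prop) : Prop :=
  ∃ x : Pt 3, (∀ i, x i = -2 ∨ x i = 0 ∨ x i = 2 ∨ x i = 4) ∧
    (¬ ∀ i, x i = 0 ∨ x i = 4) ∧ (Rx P x = R ∨ Rx P x = Rtheta R)

/-- The trace of `Ĉ_X`, the inductive limit of the sets `x_s + 𝒞^s`. -/
def hatXTrace (P : ℕ → Set (Curve 3)) (x : ℕ → Pt 3) : Trace 3 :=
  ⟨{S | ∃ s, 1 ≤ s ∧ S ∈ (Trace.transl (x s) (traceOf (P s))).segs},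
   fun S T => ∃ s, 1 ≤ s ∧ (Trace.transl (x s) (traceOf (P s))).conn S T⟩

/-- The curve `c` is equivalent to `C` (image of `C` by a positive isometry). -/
def EquivToC (c : Curve 3) : Prop :=
  ∃ f, PosIsom f ∧ curveTrace c = Trace.map f (listTrace CList)

/-- `x` is an endpoint of type `0` (resp. `1`) of the curve `c`, for `c`
equivalent to `C`. -/
def EndptType (c : Curve 3) (x : Pt 3) (ty : ℕ) : Prop :=
  ∃ f, PosIsom f ∧ curveTrace c = Trace.map f (listTrace CList) ∧
    x = f (if ty = 0 then p3 0 0 0 else p3 2 0 0)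

section Curves

variable {n : ℕ}

lemma Curve.conn.mem_left {c : Curve n} {S T : Sym2 (Pt n)} (h : c.conn S T) : S ∈ c.segs := by
  obtain ⟨i, h₁, h₂, ⟨rfl, -⟩ | ⟨-, rfl⟩⟩ := h
  · have hi : i ∈ c.dom := c.ordConn.out h₁ h₂ ⟨by omega, by omega⟩
    exact ⟨i - 1, h₁, by simpa using hi, by simp⟩
  · have hi : i ∈ c.dom := c.ordConn.out h₁ h₂ ⟨by omega, by omega⟩
    exact ⟨i, hi, h₂, rfl⟩

lemma Curve.conn.symm {c : Curve n} {S T : Sym2 (Pt n)} (h : c.conn S T) : c.conn T S := by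
  obtain ⟨i, h₁, h₂, h⟩ := h
  exact ⟨i, h₁, h₂, h.symm⟩

lemma Curve.conn.mem_right {c : Curve n} {S T : Sym2 (Pt n)} (h : c.conn S T) : T ∈ c.segs :=
  h.symm.mem_left

lemma Curve.endSegAt.isEndpt {c : Curve n} {p : Pt n} {S : Sym2 (Pt n)} (h : c.endSegAt p S) :
    c.IsEndpt p := by
  obtain ⟨i, hi, hp, ⟨h, -⟩ | ⟨h, -⟩⟩ := h
  · exact ⟨i, hi, hp, Or.inl h⟩
  · exact ⟨i, hi, hp, Or.inr h⟩

lemma Curve.endSegAt.mem {c : Curve n} {p : Pt n} {S : Sym2 (Pt n)} (h : c.endSegAt p S) :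
    p ∈ S := by
  obtain ⟨i, -, rfl, ⟨-, -, rfl⟩ | ⟨-, -, rfl⟩⟩ := h <;> simp

/-- In a set of disjoint curves, a curve containing a segment inherits its connexions. -/
lemma DisjSA.conn_of_mem {E : Set (Curve n)} (hE : DisjSA E) {c : Curve n} (hc : c ∈ E)
    {S T : Sym2 (Pt n)} (hS : S ∈ c.segs) (h : (traceOf E).conn S T) : c.conn S T := by
  obtain ⟨d, hd, h⟩ := h
  have hcd : SameCurve c d := by
    by_contra hcd
    exact hE.2 c hc d hd hcd S hS h.mem_left
  rwa [hcd.2]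

/-- No two distinct segments are connected at `p`. -/
def Unconnected (T : Trace n) (p : Pt n) : Prop := ∀ w e, w ≠ e → ¬ T.conn s(w, p) s(p, e)

lemma endSegAt_of_unconnected {E : Set (Curve n)} {c : Curve n} (hc : c ∈ E) {p q : Pt n}
    (hp : Unconnected (traceOf E) p) (h : s(p, q) ∈ c.segs) : c.endSegAt p s(p, q) := by
  obtain ⟨i, hi, hi', h⟩ := h
  have h' := h
  rw [Sym2.eq_iff] at h
  obtain ⟨rfl, rfl⟩ | ⟨rfl, rfl⟩ := h
  · refine ⟨i, hi, rfl, Or.inl ⟨fun hm => ?_, hi', rfl⟩⟩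
    exact hp (c.v (i - 1)) (c.v (i + 1)) (c.noback i hm hi').symm
      ⟨c, hc, i, hm, hi', Or.inl ⟨rfl, rfl⟩⟩
  · refine ⟨i + 1, hi', rfl, Or.inr ⟨fun hm => ?_, by simpa using hi, by simp [Sym2.eq_swap]⟩⟩
    have hi'' : i + 1 - 1 ∈ c.dom := by simpa using hi
    exact hp (c.v (i + 1 - 1)) (c.v (i + 1 + 1)) (c.noback (i + 1) hi'' hm).symm
      ⟨c, hc, i + 1, hi'', hm, Or.inl ⟨rfl, rfl⟩⟩

end Curves

section IntegerPoints

/-- Points of `ℤ³`. -/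
abbrev Z3 := ℤ × ℤ × ℤ

/-- The inclusion of `ℤ³` in `ℝ³`. -/
def emb (z : Z3) : Pt 3 := p3 z.1 z.2.1 z.2.2

@[simp] lemma emb_apply_zero (z : Z3) : emb z 0 = z.1 := rfl
@[simp] lemma emb_apply_one (z : Z3) : emb z 1 = z.2.1 := rfl
@[simp] lemma emb_apply_two (z : Z3) : emb z 2 = z.2.2 := rfl

lemma emb_injective : Function.Injective emb := by
  rintro ⟨a, b, c⟩ ⟨a', b', c'⟩ h
  have h0 := congrArg (fun p : Pt 3 => p 0) h
  have h1 := congrArg (fun p : Pt 3 => p 1) h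
  have h2 := congrArg (fun p : Pt 3 => p 2) h
  simp at h0 h1 h2
  simp [h0, h1, h2]

lemma emb_add (y z : Z3) : emb (y + z) = emb y + emb z := by
  ext i; fin_cases i <;> simp

lemma emb_zero : emb 0 = 0 := by
  ext i; fin_cases i <;> simp

lemma emb_double (z : Z3) : emb (z + z) = ((2 : ℕ) : ℝ) • emb z := by
  ext i; fin_cases i <;> simp <;> ring

lemma exists_emb_of_latt {p : Pt 3} (h : latt p) : ∃ z, p = emb z := by
  obtain ⟨a, ha⟩ := h 0
  obtain ⟨b, hb⟩ := h 1
  obtain ⟨c, hc⟩ := h 2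
  refine ⟨(a, b, c), ?_⟩
  ext i; fin_cases i <;> simp [ha, hb, hc]

lemma latt_emb (z : Z3) : latt (emb z) := by
  intro i; fin_cases i
  exacts [⟨z.1, rfl⟩, ⟨z.2.1, rfl⟩, ⟨z.2.2, rfl⟩]

/-- The canonical basis of `ℤ³`. -/
def zvec : Fin 3 → Z3 := ![(1, 0, 0), (0, 1, 0), (0, 0, 1)]

lemma emb_zvec (i : Fin 3) : emb (zvec i) = uvec 3 i := by
  ext j; fin_cases i <;> fin_cases j <;> simp [zvec, uvec]

/-- The `j`-th vertex of a list of points of `ℤ³`. -/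
def vert (L : List Z3) (j : ℕ) : Z3 := L.getD j 0

/-- The `j`-th segment of a list of vertices. -/
def seg (L : List Z3) (j : ℕ) : Sym2 (Pt 3) := s(emb (vert L j), emb (vert L (j + 1)))

lemma vert_shift {L : List Z3} {j : ℕ} (hj : j < L.length) (d : Z3) :
    vert (L.map (· + d)) j = vert L j + d := by
  simp [vert, List.getD, hj]

lemma getD_map_emb (L : List Z3) (j : ℕ) : (L.map emb).getD j 0 = emb (vert L j) := by
  rw [← emb_zero, List.getD_map, vert]

lemma vert_reverse {L : List Z3} {j : ℕ} (hj : j < L.length) :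
    vert L.reverse j = vert L (L.length - 1 - j) := by
  have : L.length - 1 - j < L.length := by omega
  simp [vert, List.getD, hj, this]

end IntegerPoints

section Covering

/-- The curves of `ℬ₀`, as lists of points of `ℤ³`. -/
def zB0 : List (List Z3) :=
  [ [(0, 0, 0), (0, -1, 0), (0, -1, -1), (0, 0, -1), (1, 0, -1), (1, -1, -1), (1, -1, 0),
      (1, 0, 0), (2, 0, 0)],
    [(0, 0, 0), (0, 0, 1), (0, 1, 1), (0, 1, 0), (-1, 1, 0), (-1, 1, 1), (-1, 0, 1),
      (-1, 0, 0), (-2, 0, 0)],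
    [(0, 0, 0), (0, 0, -1), (-1, 0, -1), (-1, 0, 0), (-1, 1, 0), (-1, 1, -1), (0, 1, -1),
      (0, 1, 0), (0, 2, 0)],
    [(0, 0, 0), (1, 0, 0), (1, 0, 1), (0, 0, 1), (0, -1, 1), (1, -1, 1), (1, -1, 0),
      (0, -1, 0), (0, -2, 0)],
    [(0, 0, 0), (-1, 0, 0), (-1, -1, 0), (0, -1, 0), (0, -1, 1), (-1, -1, 1), (-1, 0, 1),
      (0, 0, 1), (0, 0, 2)],
    [(0, 0, 0), (0, 1, 0), (1, 1, 0), (1, 0, 0), (1, 0, -1), (1, 1, -1), (0, 1, -1),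
      (0, 0, -1), (0, 0, -2)] ]

/-- The isometries carrying `ℬ₀` to the four blocks. -/
def blockMap : Fin 4 → Z3 → Z3 :=
  ![id, fun z => (2 + z.1, 2 - z.2.1, -z.2.2), fun z => (2 + z.1, z.2.2, 2 - z.2.1),
    fun z => (z.1, 2 - z.2.2, 2 + z.2.1)]

/-- The curves of the four blocks, as lists of points of `ℤ³`. -/
def zblocks : List (List Z3) :=
  (List.finRange 4).flatMap fun i => zB0.map (List.map (blockMap i))

lemma B0_eq : B0 = zB0.map (List.map emb) := rfl

lemma blockLists_eq (i : Fin 4) :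
    blockLists i = (zB0.map (List.map (blockMap i))).map (List.map emb) := by
  have hσ : (fun p => p3 2 2 0 + sigma3 p) ∘ emb = emb ∘ blockMap 1 := by
    funext z; ext j; fin_cases j <;> simp [blockMap, p3, sigma3, toPt3, emb]
    ring
  have hτ : (fun p => p3 2 0 2 + tau3 p) ∘ emb = emb ∘ blockMap 2 := by
    funext z; ext j; fin_cases j <;> simp [blockMap, p3, tau3, toPt3, emb]
    ring
  have hυ : (fun p => p3 0 2 2 + ups3 p) ∘ emb = emb ∘ blockMap 3 := by
    funext z; ext j; fin_cases j <;> simp [blockMap, p3, ups3, toPt3, emb]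
    ring
  fin_cases i
  · rfl
  · simp only [blockLists, B0_eq, List.map_map, Function.comp_def] at hσ ⊢
    simp [hσ]
  · simp only [blockLists, B0_eq, List.map_map, Function.comp_def] at hτ ⊢
    simp [hτ]
  · simp only [blockLists, B0_eq, List.map_map, Function.comp_def] at hυ ⊢
    simp [hυ]

lemma exists_block_iff {Q : List (Pt 3) → Prop} :
    (∃ i, ∃ M ∈ blockLists i, Q M) ↔ ∃ N ∈ zblocks, Q (N.map emb) := by
  simp [blockLists_eq, zblocks, -List.map_map]

/-- Multiplication by `4` in `ℤ³`. -/
def quad (u : Z3) : Z3 := (4 * u.1, 4 * u.2.1, 4 * u.2.2)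

lemma emb_quad (u : Z3) : emb (quad u) = (4 : ℝ) • emb u := by
  ext i; fin_cases i <;> simp [quad]

lemma length_of_mem_zblocks : ∀ N ∈ zblocks, N.length = 9 := by decide +kernel

lemma seg_shift {N : List Z3} (hN : N ∈ zblocks) {j : ℕ} (hj : j < 8) (u : Z3) :
    seg (N.map (· + quad u)) j =
      Sym2.map (fun p => p + (4 : ℝ) • emb u) s(emb (vert N j), emb (vert N (j + 1))) := by
  have hl := length_of_mem_zblocks N hN
  rw [seg, vert_shift (by omega), vert_shift (by omega)]
  simp [emb_add, emb_quad]

/-- `L` lists the successive vertices of a curve of `𝒞`. -/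
def IsPath (L : List Z3) : Prop := ∃ N ∈ zblocks, ∃ u, L = N.map (· + quad u)

lemma IsPath.length {L : List Z3} (hL : IsPath L) : L.length = 9 := by
  obtain ⟨N, hN, u, rfl⟩ := hL
  simpa using length_of_mem_zblocks N hN

lemma IsPath.mem_segs {L : List Z3} (hL : IsPath L) {j : ℕ} (hj : j < 8) :
    seg L j ∈ CTrace.segs := by
  obtain ⟨N, hN, u, rfl⟩ := hL
  refine ⟨emb u, latt_emb u, exists_block_iff.2 ⟨N, hN, ?_⟩⟩
  rw [seg_shift hN hj]
  have hl := length_of_mem_zblocks N hN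
  refine ⟨_, ⟨j, by simp; omega, ?_⟩, rfl⟩
  simp only [getD_map_emb]

lemma IsPath.conn {L : List Z3} (hL : IsPath L) {j : ℕ} (hj : j < 7) :
    CTrace.conn (seg L j) (seg L (j + 1)) := by
  obtain ⟨N, hN, u, rfl⟩ := hL
  refine ⟨emb u, latt_emb u, exists_block_iff.2 ⟨N, hN, ?_⟩⟩
  rw [seg_shift hN (by omega), seg_shift hN (by omega)]
  have hl := length_of_mem_zblocks N hN
  refine ⟨_, _, ⟨j, by simp; omega, Or.inl ⟨?_, ?_⟩⟩, rfl, rfl⟩ <;> simp only [getD_map_emb]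

lemma exists_isPath_of_conn {S T : Sym2 (Pt 3)} (h : CTrace.conn S T) :
    ∃ L, IsPath L ∧ ∃ j < 7, (S = seg L j ∧ T = seg L (j + 1)) ∨
      (T = seg L j ∧ S = seg L (j + 1)) := by
  obtain ⟨u, hu, hblock⟩ := h
  obtain ⟨u, rfl⟩ := exists_emb_of_latt hu
  obtain ⟨N, hN, A, B, ⟨j, hj, h⟩, rfl, rfl⟩ := exists_block_iff.1 hblock
  have hl := length_of_mem_zblocks N hN
  simp only [List.length_map, hl, getD_map_emb] at hj h
  refine ⟨_, ⟨N, hN, u, rfl⟩, j, by omega, ?_⟩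
  rw [seg_shift hN (by omega), seg_shift hN (by omega)]
  exact h.imp (fun ⟨h₁, h₂⟩ => ⟨by rw [h₁], by rw [h₂]⟩) (fun ⟨h₁, h₂⟩ => ⟨by rw [h₁], by rw [h₂]⟩)

/-- All the coordinates of `z` are even. -/
def AllEven (z : Z3) : Prop := z.1 % 2 = 0 ∧ z.2.1 % 2 = 0 ∧ z.2.2 % 2 = 0

instance (z : Z3) : Decidable (AllEven z) := inferInstanceAs (Decidable (_ ∧ _ ∧ _))

lemma allEven_add_quad {z u : Z3} : AllEven (z + quad u) ↔ AllEven z := by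
  simp only [AllEven, quad, Prod.fst_add, Prod.snd_add]
  omega

lemma zblocks_interior : ∀ N ∈ zblocks, ∀ j < 7,
    ¬ AllEven (vert N (j + 1)) ∧ vert N j ≠ vert N (j + 2) := by decide +kernel

lemma zblocks_ends : ∀ N ∈ zblocks, AllEven (vert N 0) ∧ AllEven (vert N 8) := by decide +kernel

lemma IsPath.interior {L : List Z3} (hL : IsPath L) {j : ℕ} (hj : j < 7) :
    ¬ AllEven (vert L (j + 1)) ∧ vert L j ≠ vert L (j + 2) := by
  obtain ⟨N, hN, u, rfl⟩ := hL
  have hl := length_of_mem_zblocks N hN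
  rw [vert_shift (by omega), vert_shift (by omega), vert_shift (by omega), allEven_add_quad]
  simpa using zblocks_interior N hN j hj

lemma IsPath.ends {L : List Z3} (hL : IsPath L) : AllEven (vert L 0) ∧ AllEven (vert L 8) := by
  obtain ⟨N, hN, u, rfl⟩ := hL
  have hl := length_of_mem_zblocks N hN
  rw [vert_shift (by omega), vert_shift (by omega), allEven_add_quad, allEven_add_quad]
  exact zblocks_ends N hN

/-- The curves of `𝒞` have no connexion at points of `2ℤ³`. -/
lemma not_CTrace_conn {z : Z3} (hz : AllEven z) (w e : Pt 3) :
    ¬ CTrace.conn s(w, emb z) s(emb z, e) := by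
  intro h
  obtain ⟨L, hL, j, hj, h⟩ := exists_isPath_of_conn h
  obtain ⟨h₁, h₂⟩ := hL.interior hj
  have hmem : emb z ∈ seg L j ∧ emb z ∈ seg L (j + 1) := by
    obtain ⟨h, h'⟩ | ⟨h, h'⟩ := h <;> rw [← h, ← h'] <;> simp
  simp only [seg, Sym2.mem_iff, emb_injective.eq_iff] at hmem
  obtain ⟨rfl | rfl, h | h⟩ := hmem
  · exact h₁ (h ▸ hz)
  · exact h₂ h
  · exact h₁ hz
  · exact h₁ hz

end Covering

section Convolution

/-- `L` lists the successive vertices of the curve `c`. -/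
structure Traces (c : Curve 3) (L : List Z3) : Prop where
  mem_segs : ∀ j < 8, seg L j ∈ c.segs
  conn : ∀ j < 7, c.conn (seg L j) (seg L (j + 1))
  start : c.endSegAt (emb (vert L 0)) (seg L 0)
  finish : c.endSegAt (emb (vert L 8)) (seg L 7)

lemma seg_reverse {L : List Z3} (hL : L.length = 9) {j : ℕ} (hj : j < 8) :
    seg L.reverse j = seg L (7 - j) := by
  rw [seg, vert_reverse (by omega), vert_reverse (by omega), seg, Sym2.eq_swap, hL,
    show 9 - 1 - (j + 1) = 7 - j by omega, show 9 - 1 - j = 7 - j + 1 by omega]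

lemma Traces.reverse {c : Curve 3} {L : List Z3} (hL : L.length = 9) (h : Traces c L) :
    Traces c L.reverse where
  mem_segs j hj := by
    rw [seg_reverse hL hj]
    exact h.mem_segs _ (by omega)
  conn j hj := by
    rw [seg_reverse hL (by omega), seg_reverse hL (by omega)]
    have := (h.conn (6 - j) (by omega)).symm
    rwa [show 6 - j + 1 = 7 - j by omega, show 6 - j = 7 - (j + 1) by omega] at this
  start := by
    rw [seg_reverse hL (by omega), vert_reverse (by omega), hL]
    exact h.finish
  finish := by
    rw [seg_reverse hL (by omega), vert_reverse (by omega), hL]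
    exact h.start

lemma exists_traces {C3 : Set (Curve 3)} (hC3 : traceOf C3 = CTrace) (hE : DisjSA C3)
    {L : List Z3} (hL : IsPath L) : ∃ c ∈ C3, Traces c L := by
  have h0 := hL.mem_segs (j := 0) (by omega)
  rw [← hC3] at h0
  obtain ⟨c, hc, h0⟩ := h0
  have hmem : ∀ j < 8, seg L j ∈ c.segs := by
    intro j
    induction j with
    | zero => exact fun _ => h0
    | succ j ih =>
      intro hj
      exact (hE.conn_of_mem hc (ih (by omega)) (hC3 ▸ hL.conn (by omega))).mem_right
  have hU : ∀ z, AllEven z → Unconnected (traceOf C3) (emb z) := fun z hz w e _ => by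
    rw [hC3]; exact not_CTrace_conn hz w e
  refine ⟨c, hc, hmem, fun j hj =>
    hE.conn_of_mem hc (hmem j (by omega)) (hC3 ▸ hL.conn hj),
    endSegAt_of_unconnected hc (hU _ hL.ends.1) (hmem 0 (by omega)), ?_⟩
  rw [seg, Sym2.eq_swap]
  refine endSegAt_of_unconnected hc (hU _ hL.ends.2) ?_
  rw [Sym2.eq_swap]
  exact hmem 7 (by omega)

variable {C3 : Set (Curve 3)} {P : ℕ → Set (Curve 3)}

lemma PowersOf.one_conn (hP : PowersOf C3 2 P) {S T : Sym2 (Pt 3)}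
    (h : (traceOf (P 1)).conn S T) : (traceOf C3).conn S T := by
  rw [hP.2.2 0] at h
  obtain ⟨a, b, -, c, hc, -, -, h⟩ | ⟨a, b, d, h, -⟩ := h
  · exact ⟨c, hc, h⟩
  · rw [hP.2.1] at h
    exact h.elim

/-- The curves of `𝒞²` have no connexion at `0`. -/
lemma PowersOf.unconnected_zero (hC3 : traceOf C3 = CTrace) (hP : PowersOf C3 2 P) :
    Unconnected (traceOf (P 2)) 0 := by
  have hfree : ∀ w e, ¬ (traceOf C3).conn s(w, 0) s(0, e) := fun w e => by
    rw [hC3, ← emb_zero]; exact not_CTrace_conn (by decide) w e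
  intro w e hwe h
  rw [hP.2.2 1] at h
  obtain ⟨a, b, -, c, hc, -, -, h⟩ | ⟨a, b, d, h, c, hc, c', hc', -, -, -, -, h'⟩ := h
  · exact hfree w e ⟨c, hc, h⟩
  · have hmem : ((2 : ℕ) : ℝ) • b ∈ s(w, 0) ∧ ((2 : ℕ) : ℝ) • b ∈ s(0, e) := by
      obtain ⟨h₁, h₂⟩ | ⟨h₁, h₂⟩ := h'
      exacts [⟨h₁.mem, h₂.mem⟩, ⟨h₂.mem, h₁.mem⟩]
    have hb : ((2 : ℕ) : ℝ) • b = 0 := by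
      simp only [Sym2.mem_iff] at hmem
      obtain ⟨h₁ | h₁, h₂ | h₂⟩ := hmem
      exacts [h₂, (hwe (h₁.symm.trans h₂)).elim, h₁, h₁]
    obtain rfl : b = 0 := by simpa using hb
    exact hfree _ _ (hP.one_conn h)

/-- A curve of `𝒞` starting at `0` and ending at twice a unit vector also appears in `𝒞¹`. -/
lemma PowersOf.one_of_traces (hP : PowersOf C3 2 P) {c : Curve 3} (hc : c ∈ C3) {M : List Z3}
    (h : Traces c M) {b : Z3} (h0 : vert M 0 = 0) (h8 : vert M 8 = b + b)
    (hb : IsSeg s(0, emb b)) :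
    (∀ j < 8, seg M j ∈ (traceOf (P 1)).segs) ∧
      ∀ j < 7, (traceOf (P 1)).conn (seg M j) (seg M (j + 1)) := by
  have hs : s(0, emb b) ∈ (traceOf (P 0)).segs := by rw [hP.2.1]; exact hb
  have e0 : c.IsEndpt (((2 : ℕ) : ℝ) • (0 : Pt 3)) := by
    have := h.start.isEndpt
    rwa [h0, emb_zero, ← smul_zero ((2 : ℕ) : ℝ)] at this
  have e8 : c.IsEndpt (((2 : ℕ) : ℝ) • emb b) := by
    have := h.finish.isEndpt
    rwa [h8, emb_double] at this
  rw [hP.2.2 0]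
  exact ⟨fun j hj => ⟨_, _, hs, c, hc, e0, e8, h.mem_segs j hj⟩,
    fun j hj => Or.inl ⟨_, _, hs, c, hc, e0, e8, h.conn j hj⟩⟩

/-- Following the curves of `𝒞` which replace the segments of a curve of `𝒞¹`. -/
lemma PowersOf.first_mem (hP : PowersOf C3 2 P) {M : List Z3}
    (hM : ∀ j < 7, (traceOf (P 1)).conn (seg M j) (seg M (j + 1)))
    (hMs : ∀ j < 8, seg M j ∈ (traceOf (P 1)).segs) {N : ℕ → List Z3}
    (hN : ∀ k < 8, ∃ c ∈ C3, Traces c (N k))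
    (h0 : ∀ k < 8, vert (N k) 0 = vert M k + vert M k)
    (h8 : ∀ k < 8, vert (N k) 8 = vert M (k + 1) + vert M (k + 1))
    {c : Curve 3} (hc : c ∈ P 2) {k j : ℕ} (hk : k < 8) (hj : j < 8)
    (h : seg (N k) j ∈ c.segs) : seg (N 0) 0 ∈ c.segs := by
  have hE := hP.1 2
  have ends : ∀ k < 8, ∀ d, Traces d (N k) →
      d.IsEndpt (((2 : ℕ) : ℝ) • emb (vert M k)) ∧
      d.IsEndpt (((2 : ℕ) : ℝ) • emb (vert M (k + 1))) := fun k hk d hd => by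
    rw [← emb_double, ← emb_double, ← h0 k hk, ← h8 k hk]
    exact ⟨hd.start.isEndpt, hd.finish.isEndpt⟩
  have back : ∀ k < 8, ∀ j < 8, seg (N k) j ∈ c.segs → seg (N k) 0 ∈ c.segs := by
    intro k hk j
    induction j with
    | zero => exact fun _ => id
    | succ j ih =>
      intro hj h
      obtain ⟨d, hd, hdN⟩ := hN k hk
      refine ih (by omega) (hE.conn_of_mem hc h ?_).mem_right
      rw [hP.2.2 1]
      exact Or.inl ⟨_, _, hMs k hk, d, hd, (ends k hk d hdN).1, (ends k hk d hdN).2,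
        (hdN.conn j (by omega)).symm⟩
  induction k generalizing j with
  | zero => exact back 0 hk j hj h
  | succ k ih =>
    obtain ⟨d, hd, hdN⟩ := hN k (by omega)
    obtain ⟨d', hd', hdN'⟩ := hN (k + 1) hk
    refine ih (j := 7) (by omega) (by omega)
      (hE.conn_of_mem hc (back _ hk j hj h) ?_).mem_right
    have e := ends k (by omega) d hdN
    have e' := ends (k + 1) hk d' hdN'
    rw [hP.2.2 1]
    refine Or.inr ⟨_, _, _, hM k (by omega), d, hd, d', hd', e.1, e.2, e'.1, e'.2, Or.inr ⟨?_, ?_⟩⟩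
    · rw [← emb_double, ← h8 k (by omega)]
      exact hdN.finish
    · rw [← emb_double, ← h0 (k + 1) hk]
      exact hdN'.start

end Convolution

section Routes

/-- The curve of `𝒞` from `a` to `b`, if its list in `𝒞` begins at `a`. -/
def straight (a b : Z3) : Option (List Z3) :=
  zblocks.findSome? fun N =>
    let d := a - vert N 0
    let u : Z3 := (d.1 / 4, d.2.1 / 4, d.2.2 / 4)
    if vert N 0 + quad u = a ∧ vert N 8 + quad u = b then some (N.map (· + quad u)) else none

/-- The curve of `𝒞` from `a` to `b`. -/
def route (a b : Z3) : List Z3 :=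
  ((straight a b).or ((straight b a).map List.reverse)).getD []

lemma isPath_of_straight {a b : Z3} {L : List Z3} (h : straight a b = some L) : IsPath L := by
  obtain ⟨N, hN, h⟩ := List.exists_of_findSome?_eq_some h
  simp only [Option.ite_none_right_eq_some, Option.some.injEq] at h
  exact ⟨N, hN, _, h.2.symm⟩

lemma exists_traces_route {C3 : Set (Curve 3)} (hC3 : traceOf C3 = CTrace) (hE : DisjSA C3)
    {a b : Z3} (h : route a b ≠ []) : ∃ c ∈ C3, Traces c (route a b) := by
  rw [route] at h ⊢
  cases hab : straight a b with
  | some L => exact exists_traces hC3 hE (isPath_of_straight hab)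
  | none =>
    cases hba : straight b a with
    | some L =>
      obtain ⟨c, hc, h⟩ := exists_traces hC3 hE (isPath_of_straight hba)
      exact ⟨c, hc, h.reverse (isPath_of_straight hba).length⟩
    | none => simp [hab, hba] at h

/-- The curve of `𝒞` replacing the `k`-th segment of `M` in the convolution product. -/
def subRoute (M : List Z3) (k : ℕ) : List Z3 :=
  route (vert M k + vert M k) (vert M (k + 1) + vert M (k + 1))

lemma subRoute_spec : ∀ M ∈ zB0, ∀ k < 8, (subRoute M k).length = 9 ∧
    vert (subRoute M k) 0 = vert M k + vert M k ∧
    vert (subRoute M k) 8 = vert M (k + 1) + vert M (k + 1) := by decide +kernel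

lemma vert_zero_of_mem_zB0 : ∀ M ∈ zB0, vert M 0 = 0 := by decide

lemma isPath_of_mem_zB0 {M : List Z3} (hM : M ∈ zB0) : IsPath M := by
  refine ⟨M, List.mem_flatMap.2 ⟨0, by simp, ?_⟩, 0, ?_⟩
  · simpa [blockMap] using hM
  · simp [quad, ← Prod.zero_eq_mk]

lemma zB0_end : ∀ M ∈ zB0, ∃ i : Fin 3, vert M 8 = zvec i + zvec i ∨
    vert M 8 = -zvec i + -zvec i := by decide +kernel

/-- The segments, as ordered pairs, of the curves of `𝒞²` with endpoint `0`. -/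
def routePairs : List (Z3 × Z3) :=
  zB0.flatMap fun M => (List.range 8).flatMap fun k =>
    (subRoute M k).zip (subRoute M k).tail

/-- The possible `j`-th coordinates of the points `z` for which `[z, z + e_i]` meets `P_{0,1}`. -/
def nearRange (i j : Fin 3) : List ℤ := if j = i then [-2, -1, 0, 1] else [-1, 0, 1]

/-- The points `z` for which `[z, z + e_i]` meets `P_{0,1}`. -/
def nearCube (i : Fin 3) : List Z3 :=
  nearRange i 0 ×ˢ nearRange i 1 ×ˢ nearRange i 2

lemma nearCube_covered : ∀ i, ∀ z ∈ nearCube i,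
    (z, z + zvec i) ∈ routePairs ∨ (z + zvec i, z) ∈ routePairs := by decide +kernel

lemma exists_seg_of_mem_routePairs {y z : Z3} (h : (y, z) ∈ routePairs) :
    ∃ M ∈ zB0, ∃ k < 8, ∃ j < 8, s(emb y, emb z) = seg (subRoute M k) j := by
  simp only [routePairs, List.mem_flatMap, List.mem_range] at h
  obtain ⟨M, hM, k, hk, h⟩ := h
  obtain ⟨j, hj, h⟩ := List.mem_iff_getElem.1 h
  have hl := (subRoute_spec M hM k hk).1
  have hj' : j < 8 := by simp [hl] at hj; omega
  simp only [List.getElem_zip, List.getElem_tail, Prod.mk.injEq] at h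
  refine ⟨M, hM, k, hk, j, hj', ?_⟩
  rw [seg, vert, vert, List.getD_eq_getElem _ _ (by omega), List.getD_eq_getElem _ _ (by omega),
    h.1, h.2]

lemma exists_seg_of_mem_nearCube {i : Fin 3} {z : Z3} (hz : z ∈ nearCube i) :
    ∃ M ∈ zB0, ∃ k < 8, ∃ j < 8, s(emb z, emb z + uvec 3 i) = seg (subRoute M k) j := by
  rw [← emb_zvec, ← emb_add]
  obtain h | h := nearCube_covered i z hz
  · exact exists_seg_of_mem_routePairs h
  · rw [Sym2.eq_swap]
    exact exists_seg_of_mem_routePairs h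

lemma exists_near_of_isSeg {S : Sym2 (Pt 3)} (hS : IsSeg S)
    (hX : (segPts S ∩ cube (0 : Pt 3) 1).Nonempty) :
    ∃ i, ∃ z ∈ nearCube i, S = s(emb z, emb z + uvec 3 i) := by
  obtain ⟨x, i, hx, rfl⟩ := hS
  obtain ⟨z, rfl⟩ := exists_emb_of_latt hx
  obtain ⟨q, ⟨a, b, hab, t, ht0, ht1, hq⟩, hcube⟩ := hX
  obtain ⟨t, ht0, ht1, rfl⟩ : ∃ t : ℝ, 0 ≤ t ∧ t ≤ 1 ∧ q = emb z + t • uvec 3 i := by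
    rw [Sym2.eq_iff] at hab
    obtain ⟨rfl, rfl⟩ | ⟨rfl, rfl⟩ := hab
    · exact ⟨t, ht0, ht1, by rw [hq, add_sub_cancel_left]⟩
    · exact ⟨1 - t, by linarith, by linarith, by rw [hq]; module⟩
  refine ⟨i, z, ?_, rfl⟩
  have mem_range (j : Fin 3) (m : ℤ) (hm : emb z j = m) : m ∈ nearRange i j := by
    have h := hcube j
    by_cases hji : j = i
    · subst hji
      simp [uvec, hm] at h
      have h₁ : -2 ≤ m := by
        have : (-2 : ℝ) ≤ m := by linarith
        exact_mod_cast this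
      have h₂ : m ≤ 1 := by
        have : (m : ℝ) ≤ 1 := by linarith
        exact_mod_cast this
      simp [nearRange]
      omega
    · simp [uvec, hm, hji] at h
      have h₁ : -1 ≤ m := by exact_mod_cast h.1
      have h₂ : m ≤ 1 := by exact_mod_cast h.2
      simp [nearRange, hji]
      omega
  exact List.mem_product.2 ⟨mem_range 0 _ rfl, List.mem_product.2
    ⟨mem_range 1 _ rfl, mem_range 2 _ rfl⟩⟩

lemma isSeg_zero_emb {b : Z3} (h : ∃ i, b = zvec i ∨ b = -zvec i) : IsSeg s(0, emb b) := by
  obtain ⟨i, rfl | rfl⟩ := h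
  · exact ⟨emb 0, i, latt_emb 0, by rw [emb_zero, emb_zvec, zero_add]⟩
  · refine ⟨emb (-zvec i), i, latt_emb _, ?_⟩
    rw [← emb_zvec, ← emb_add, neg_add_cancel, emb_zero, Sym2.eq_swap]

end Routes


/-- Proposition 2.3: `𝒟₂`, the set of curves of `𝒞²` having `0` as an
endpoint, covers the cube `P_{0,1}`. -/
theorem statement10 (C3 : Set (Curve 3)) (hC3 : traceOf C3 = CTrace)
    (hH : SatH C3 2 4) (P : ℕ → Set (Curve 3)) (hP : PowersOf C3 2 P) :
    Covers {c | c ∈ P 2 ∧ c.IsEndpt 0} (cube (0 : Pt 3) 1) := by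
  have hE := hH.2.2.2.1.1
  intro S hS hX
  refine ⟨?_, fun c hc d hd hcS hdS => ?_⟩
  · obtain ⟨i, z, hz, rfl⟩ := exists_near_of_isSeg hS hX
    obtain ⟨M, hM, k, hk, j, hj, hseg⟩ := exists_seg_of_mem_nearCube hz
    have h0 := vert_zero_of_mem_zB0 M hM
    obtain ⟨b, hb, h8⟩ : ∃ b, (∃ i, b = zvec i ∨ b = -zvec i) ∧ vert M 8 = b + b := by
      obtain ⟨i, h | h⟩ := zB0_end M hM
      exacts [⟨_, ⟨i, Or.inl rfl⟩, h⟩, ⟨_, ⟨i, Or.inr rfl⟩, h⟩]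
    obtain ⟨c₁, hc₁, hc₁M⟩ := exists_traces hC3 hE (isPath_of_mem_zB0 hM)
    obtain ⟨hMs, hMc⟩ := hP.one_of_traces hc₁ hc₁M h0 h8 (isSeg_zero_emb hb)
    have hN : ∀ k < 8, ∃ c ∈ C3, Traces c (subRoute M k) := fun k hk =>
      exists_traces_route hC3 hE
        (List.ne_nil_of_length_pos (by rw [← subRoute, (subRoute_spec M hM k hk).1]; omega))
    have hmem : seg (subRoute M k) j ∈ (traceOf (P 2)).segs := by
      obtain ⟨d, hd, hdN⟩ := hN k hk
      rw [hP.2.2 1]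
      refine ⟨_, _, hMs k hk, d, hd, ?_, ?_, hdN.mem_segs j hj⟩
      · rw [← emb_double, ← (subRoute_spec M hM k hk).2.1]
        exact hdN.start.isEndpt
      · rw [← emb_double, ← (subRoute_spec M hM k hk).2.2]
        exact hdN.finish.isEndpt
    obtain ⟨c, hc, hcS⟩ := hmem
    have hfirst := hP.first_mem hMc hMs hN (fun k hk => (subRoute_spec M hM k hk).2.1)
      (fun k hk => (subRoute_spec M hM k hk).2.2) hc hk hj hcS
    rw [seg, (subRoute_spec M hM 0 (by omega)).2.1, h0, add_zero, emb_zero] at hfirst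
    exact ⟨c, ⟨hc, (endSegAt_of_unconnected hc (hP.unconnected_zero hC3) hfirst).isEndpt⟩,
      hseg ▸ hcS⟩
  · by_contra hcd
    exact (hP.1 2).2 c hc.1 d hd.1 hcd S hcS hdS

end
end Folding
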